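/- arXiv:1905.01753 — 3 statements merged into one kernel-verified Lean document; each statement's English description precedes it below -/
import Mathlib

section
/- For every integer n ≥ 3, there is no injective group homomorphism from SL(n,ℤ) into SL(2,ℝ); that is, SL(n,ℤ) is not isomorphic to any subgroup of SL(2,ℝ). -/
namespace Matrix

/-- Over an integral domain, two `2 × 2` matrices commuting with a common non-scalar matrix commute
with each other. -/
lemma commute_or_eq_scalar_of_commute {R : Type*} [CommRing R] [IsDomain R]
    {X Y Z : Matrix (Fin 2) (Fin 2) R} (hX : Commute X Z) (hY : Commute Y Z) :
    Commute X Y ∨ Z = scalar (Fin 2) (Z 0 0) := by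
  have hX' := fun i j => congrFun (congrFun hX.eq i) j
  have hY' := fun i j => congrFun (congrFun hY.eq i) j
  simp only [mul_apply, Fin.sum_univ_two] at hX' hY'
  have x00 := hX' 0 0
  have x01 := hX' 0 1
  have x10 := hX' 1 0
  have y00 := hY' 0 0
  have y01 := hY' 0 1
  have y10 := hY' 1 0
  have commute_of (w : R) (hw : w ≠ 0)
      (h00 : w * (X 0 1 * Y 1 0 - X 1 0 * Y 0 1) = 0)
      (h01 : w * ((X 0 0 - X 1 1) * Y 0 1 - X 0 1 * (Y 0 0 - Y 1 1)) = 0)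
      (h10 : w * ((X 0 0 - X 1 1) * Y 1 0 - X 1 0 * (Y 0 0 - Y 1 1)) = 0) : Commute X Y := by
    have h00 := (mul_eq_zero.mp h00).resolve_left hw
    have h01 := (mul_eq_zero.mp h01).resolve_left hw
    have h10 := (mul_eq_zero.mp h10).resolve_left hw
    ext i j
    fin_cases i <;> fin_cases j <;> simp [mul_apply, Fin.sum_univ_two] <;> grind
  by_cases hb : Z 0 1 = 0
  · by_cases hc : Z 1 0 = 0
    · by_cases hd : Z 0 0 - Z 1 1 = 0
      · right
        ext i j
        fin_cases i <;> fin_cases j <;> simp [hb, hc]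
        grind
      · exact .inl (commute_of _ hd (by grind) (by grind) (by grind))
    · exact .inl (commute_of _ hc (by grind) (by grind) (by grind))
  · exact .inl (commute_of _ hb (by grind) (by grind) (by grind))

namespace SpecialLinearGroup

/-- In `SL(2, R)` over an integral domain, a commutator of two elements which commutes with both
of them squares to `1`. -/
lemma sq_eq_one_of_mul_eq_mul_mul {R : Type*} [CommRing R] [IsDomain R]
    {x y z : SpecialLinearGroup (Fin 2) R} (hx : Commute x z) (hy : Commute y z)
    (h : x * y = z * (y * x)) : z ^ 2 = 1 := by
  rcases commute_or_eq_scalar_of_commute (congrArg Subtype.val hx.eq)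
    (congrArg Subtype.val hy.eq) with hxy | hz
  · have hxy : x * y = y * x := Subtype.ext hxy.eq
    rw [hxy, right_eq_mul] at h
    rw [h, one_pow]
  · have hdet := z.det_coe
    rw [hz, scalar_apply, det_diagonal, Fin.prod_univ_two, ← sq] at hdet
    apply Subtype.ext
    rw [coe_pow, hz, ← map_pow, hdet, map_one, coe_one]

lemma commute_transvection {ι R : Type*} [Fintype ι] [DecidableEq ι] [CommRing R] {i j k l : ι}
    (hij : i ≠ j) (hkl : k ≠ l) (hjk : j ≠ k) (hli : l ≠ i) (a b : R) :
    Commute (transvection hij a) (transvection hkl b) :=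
  Subtype.ext <| by
    simp [transvection_coe, mul_add, add_mul, hjk, hli]
    abel

lemma transvection_mul_transvection {ι R : Type*} [Fintype ι] [DecidableEq ι] [CommRing R]
    {i j k : ι} (hij : i ≠ j) (hjk : j ≠ k) (hik : i ≠ k) (a b : R) :
    transvection hij a * transvection hjk b =
      transvection hik (a * b) * (transvection hjk b * transvection hij a) :=
  Subtype.ext <| by
    simp [transvection_coe, mul_add, add_mul, hjk.symm, hik.symm]
    abel

end SpecialLinearGroup

end Matrix

open Matrix.SpecialLinearGroup in
/-- For every `n ≥ 3`, the group `SL(n,ℤ)` is not isomorphic to any subgroup of `SL(2,ℝ)`: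
there is no injective group homomorphism `SL(n,ℤ) → SL(2,ℝ)`. -/
theorem no_injective_hom_SLnZ_to_SL2R (n : ℕ) (hn : 3 ≤ n) :
    ¬ ∃ f : Matrix.SpecialLinearGroup (Fin n) ℤ →* Matrix.SpecialLinearGroup (Fin 2) ℝ,
        Function.Injective f := by
  rintro ⟨f, hf⟩
  let i : Fin n := ⟨0, by omega⟩
  let j : Fin n := ⟨1, by omega⟩
  let k : Fin n := ⟨2, by omega⟩
  have hij : i ≠ j := by simp [i, j]
  have hjk : j ≠ k := by simp [j, k]
  have hik : i ≠ k := by simp [i, k]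
  have hx : Commute (transvection hij (1 : ℤ)) (transvection hik 1) :=
    commute_transvection hij hik hij.symm hik.symm 1 1
  have hy : Commute (transvection hjk (1 : ℤ)) (transvection hik 1) :=
    commute_transvection hjk hik hik.symm hjk.symm 1 1
  have hxy := congrArg f (transvection_mul_transvection hij hjk hik (1 : ℤ) 1)
  simp only [map_mul, mul_one] at hxy
  have hsq := sq_eq_one_of_mul_eq_mul_mul (hx.map f) (hy.map f) hxy
  rw [← map_pow, ← map_one f] at hsq
  have hz := hf hsq
  rw [sq, ← transvection_add] at hz
  have hmem := (transvection_mem_center_iff hik (1 + 1 : ℤ)).mp (hz ▸ one_mem _)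
  norm_num at hmem
end

section
/- Let 𝕋² = ℝ²/ℤ² with quotient map π : ℝ² → 𝕋², and let SL(2,ℤ) act on 𝕋² by the maps induced from the linear action on ℝ². Every closed subset S ⊆ 𝕋² that is invariant under this action (i.e., for every A ∈ SL(2,ℤ) and every v ∈ ℝ² with π(v) ∈ S one has π(Av) ∈ S) is either a finite set or equal to all of 𝕋². -/
/-- The integer lattice `ℤ² ⊆ ℝ²`, as an additive subgroup of `Fin 2 → ℝ`. -/
def intLattice : AddSubgroup (Fin 2 → ℝ) where
  carrier := {v | ∀ i, ∃ n : ℤ, v i = n}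
  zero_mem' := fun _ => ⟨0, by simp⟩
  add_mem' := by
    rintro a b ha hb i
    obtain ⟨m, hm⟩ := ha i
    obtain ⟨n, hn⟩ := hb i
    exact ⟨m + n, by simp [Pi.add_apply, hm, hn]⟩
  neg_mem' := by
    rintro a ha i
    obtain ⟨m, hm⟩ := ha i
    exact ⟨-m, by simp [Pi.neg_apply, hm]⟩

/-- The 2-torus `𝕋² = ℝ²/ℤ²`. -/
abbrev Torus2 : Type := (Fin 2 → ℝ) ⧸ intLattice

/-- A closed set of reals containing `y + m + n * x` for all integers `m` and `n`, with `x`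
irrational, contains every real. -/
theorem mem_of_forall_add_int_mul_mem {F : Set ℝ} (hF : IsClosed F) {x y : ℝ}
    (hx : Irrational x) (h : ∀ m n : ℤ, y + m + n * x ∈ F) (z : ℝ) : z ∈ F := by
  have hd : Dense (AddSubgroup.closure {x, 1} : Set ℝ) := by
    rw [dense_addSubgroupClosure_pair_iff]
    simpa using hx
  have hG : IsClosed ((fun t => y + t) ⁻¹' F) := hF.preimage (by fun_prop)
  have hsub : (AddSubgroup.closure {x, 1} : Set ℝ) ⊆ (fun t => y + t) ⁻¹' F := by
    intro t ht
    obtain ⟨n, m, rfl⟩ := AddSubgroup.mem_closure_pair.1 ht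
    have := h m n
    simp only [Set.mem_preimage, zsmul_eq_mul, mul_one]
    convert this using 1
    ring
  have hz : z - y ∈ (fun t => y + t) ⁻¹' F := hG.closure_subset_iff.2 hsub (hd (z - y))
  simpa using hz

/-- Two rationals have a positive common denominator coprime to the gcd of the resulting
numerators. -/
theorem exists_common_denominator {x y : ℝ} (hx : ¬ Irrational x) (hy : ¬ Irrational y) :
    ∃ (q : ℕ) (a b : ℤ), 0 < q ∧ q * x = a ∧ q * y = b ∧ Int.gcd (Int.gcd a b) q = 1 := by
  classical
  have hex : ∃ q : ℕ, 0 < q ∧ ∃ a b : ℤ, q * x = a ∧ q * y = b := by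
    simp only [Irrational, not_not, Set.mem_range] at hx hy
    obtain ⟨r, rfl⟩ := hx
    obtain ⟨s, rfl⟩ := hy
    refine ⟨r.den * s.den, Nat.mul_pos r.pos s.pos, r.num * s.den, s.num * r.den, ?_, ?_⟩
    · have : (r.den : ℝ) * r = r.num := by exact_mod_cast Rat.den_mul_eq_num r
      push_cast
      linear_combination (s.den : ℝ) * this
    · have : (s.den : ℝ) * s = s.num := by exact_mod_cast Rat.den_mul_eq_num s
      push_cast
      linear_combination (r.den : ℝ) * this
  obtain ⟨hq, a, b, ha, hb⟩ := Nat.find_spec hex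
  have hmin := fun m => Nat.find_min' hex (m := m)
  generalize Nat.find hex = q at *
  refine ⟨q, a, b, hq, ha, hb, ?_⟩
  set d := Int.gcd (Int.gcd a b) q with hd
  have hdq : d ∣ q := by exact_mod_cast Int.gcd_dvd_right (Int.gcd a b : ℤ) (q : ℤ)
  have hdg : (d : ℤ) ∣ Int.gcd a b := Int.gcd_dvd_left _ _
  obtain ⟨a', ha'⟩ := hdg.trans (Int.gcd_dvd_left _ _)
  obtain ⟨b', hb'⟩ := hdg.trans (Int.gcd_dvd_right _ _)
  obtain ⟨k, hk⟩ := hdq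
  have hd0 : 0 < d := Nat.pos_of_ne_zero (by rintro h; simp [h] at hk; omega)
  have hk0 : 0 < k := Nat.pos_of_ne_zero (by rintro h; simp [h] at hk; omega)
  have hd0' : (d : ℝ) ≠ 0 := by exact_mod_cast hd0.ne'
  clear_value d
  subst hk ha' hb'
  have := hmin k ⟨hk0, a', b',
    mul_left_cancel₀ hd0' (by push_cast at ha; linear_combination ha),
    mul_left_cancel₀ hd0' (by push_cast at hb; linear_combination hb)⟩
  nlinarith

theorem forall_of_irrational_left {P : ℝ → ℝ → Prop} (hP : IsClosed {p : ℝ × ℝ | P p.1 p.2})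
    (htr : ∀ x y, P x y → ∀ m n : ℤ, P (x + m) (y + n))
    (hSL : ∀ x y, P x y → ∀ a b c d : ℤ, a * d - b * c = 1 → P (a * x + b * y) (c * x + d * y))
    {x y : ℝ} (hx : Irrational x) (h : P x y) (u v : ℝ) :
    P u v := by
  have hvert : ∀ z, P x z :=
    mem_of_forall_add_int_mul_mem (F := {z | P x z}) (y := y)
      (hP.preimage (f := fun z => (x, z)) (by fun_prop)) hx fun m n => by
      have := htr _ _ (hSL _ _ h 1 0 n 1 (by ring)) 0 m
      simp only [Set.mem_ofPred_eq]
      convert this using 1 <;> push_cast <;> ring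
  have hhor : ∀ z, Irrational z → P u z := fun z hz =>
    mem_of_forall_add_int_mul_mem (F := {t | P t z}) (y := x)
      (hP.preimage (f := fun t => (t, z)) (by fun_prop)) hz (fun m n => by
        have := htr _ _ (hSL _ _ (hvert z) 1 n 0 1 (by ring)) m 0
        simp only [Set.mem_ofPred_eq]
        convert this using 1 <;> push_cast <;> ring) u
  have hcl : IsClosed {z | P u z} := hP.preimage (f := fun z => (u, z)) (by fun_prop)
  exact hcl.closure_subset_iff.2 hhor (dense_irrational v)

theorem forall_of_irrational {P : ℝ → ℝ → Prop} (hP : IsClosed {p : ℝ × ℝ | P p.1 p.2})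
    (htr : ∀ x y, P x y → ∀ m n : ℤ, P (x + m) (y + n))
    (hSL : ∀ x y, P x y → ∀ a b c d : ℤ, a * d - b * c = 1 → P (a * x + b * y) (c * x + d * y))
    {x y : ℝ} (hxy : Irrational x ∨ Irrational y) (h : P x y)
    (u v : ℝ) : P u v := by
  rcases hxy with hx | hy
  · exact forall_of_irrational_left hP htr hSL hx h u v
  · refine forall_of_irrational_left (x := -y) (y := x) hP htr hSL hy.neg ?_ u v
    convert hSL _ _ h 0 (-1) 1 0 (by ring) using 1 <;> push_cast <;> ring

/-- The orbit of a rational point of exact denominator `q` contains every `(j / q, 1 / q)`. -/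
theorem int_div_one_div_of_rational {P : ℝ → ℝ → Prop}
    (htr : ∀ x y, P x y → ∀ m n : ℤ, P (x + m) (y + n))
    (hSL : ∀ x y, P x y → ∀ a b c d : ℤ, a * d - b * c = 1 → P (a * x + b * y) (c * x + d * y))
    {x y : ℝ} (h : P x y) {q : ℕ} {a b : ℤ} (hq : 0 < q)
    (ha : q * x = a) (hb : q * y = b) (hg : Int.gcd (Int.gcd a b) q = 1) (j : ℤ) :
    P (j / q) (1 / q) := by
  have hq' : (q : ℝ) ≠ 0 := by exact_mod_cast hq.ne'
  have hx : x = a / q := by rw [← ha]; field_simp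
  have hy : y = b / q := by rw [← hb]; field_simp
  subst hx hy
  set g := Int.gcd a b with hgdef
  have hred : P (g / q) 0 := by
    rcases Nat.eq_zero_or_pos g with h0 | h0
    · obtain ⟨rfl, rfl⟩ := Int.gcd_eq_zero_iff.1 (hgdef.symm.trans h0)
      simpa [h0] using h
    have hbez := Int.gcd_eq_gcd_ab a b
    rw [← hgdef] at hbez
    obtain ⟨a', ha'⟩ : (g : ℤ) ∣ a := Int.gcd_dvd_left _ _
    obtain ⟨b', hb'⟩ : (g : ℤ) ∣ b := Int.gcd_dvd_right _ _
    have hdet : Int.gcdA a b * a' - Int.gcdB a b * (-b') = 1 := by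
      have hg0 : (g : ℤ) ≠ 0 := by exact_mod_cast h0.ne'
      apply mul_left_cancel₀ hg0
      linear_combination (-1) * hbez - Int.gcdA a b * ha' - Int.gcdB a b * hb'
    convert hSL _ _ h _ _ _ _ hdet using 1
    · have : (g : ℝ) = a * Int.gcdA a b + b * Int.gcdB a b := by exact_mod_cast hbez
      rw [this]; ring
    · have h1 : (a : ℝ) = g * a' := by exact_mod_cast ha'
      have h2 : (b : ℝ) = g * b' := by exact_mod_cast hb'
      push_cast
      rw [h1, h2]; ring
  have hbez := Int.gcd_eq_gcd_ab g q
  rw [hg] at hbez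
  generalize Int.gcdA g q = s at hbez
  generalize Int.gcdB g q = t at hbez
  have hone : P (g / q) (1 / q) := by
    convert htr _ _ (hSL _ _ hred 1 0 s 1 (by ring)) 0 t using 1
    · push_cast; ring
    · have : (1 : ℝ) = g * s + q * t := by exact_mod_cast hbez
      rw [this]; field_simp; ring
  convert hSL _ _ hone 1 (j - g) 0 1 (by ring) using 1 <;> push_cast <;> ring

theorem forall_of_unbounded_denominators {P : ℝ → ℝ → Prop}
    (hP : IsClosed {p : ℝ × ℝ | P p.1 p.2})
    (htr : ∀ x y, P x y → ∀ m n : ℤ, P (x + m) (y + n))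
    (hSL : ∀ x y, P x y → ∀ a b c d : ℤ, a * d - b * c = 1 → P (a * x + b * y) (c * x + d * y))
    (h : ∀ N : ℕ, ∃ q : ℕ, N < q ∧ ∀ j : ℤ, P (j / q) (1 / q)) (u v : ℝ) : P u v := by
  choose q hNq hq using h
  have hqtop : Filter.Tendsto (fun N => (q N : ℝ)) Filter.atTop Filter.atTop :=
    tendsto_natCast_atTop_atTop.comp
      (Filter.tendsto_atTop_mono (fun N => (hNq N).le) Filter.tendsto_id)
  have hlim : Filter.Tendsto (fun N => (((⌊√2 * (q N : ℝ)⌋₊ : ℤ) : ℝ) / q N, 1 / (q N : ℝ)))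
      Filter.atTop (nhds (√2, 0)) := by
    refine Filter.Tendsto.prodMk_nhds ?_ ?_
    · simpa [Function.comp_def] using
      (tendsto_nat_floor_mul_div_atTop (Real.sqrt_nonneg 2)).comp hqtop
    · simpa [Function.comp_def] using tendsto_inv_atTop_zero.comp hqtop
  have hmem : P √2 0 :=
    hP.mem_of_tendsto hlim (Filter.Eventually.of_forall fun N => hq N _)
  exact forall_of_irrational hP htr hSL (Or.inl irrational_sqrt_two) hmem u v

/-- Either `P` holds everywhere, or the points satisfying `P` have a common denominator. -/
theorem forall_or_exists_common_denominator {P : ℝ → ℝ → Prop}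
    (hP : IsClosed {p : ℝ × ℝ | P p.1 p.2})
    (htr : ∀ x y, P x y → ∀ m n : ℤ, P (x + m) (y + n))
    (hSL : ∀ x y, P x y → ∀ a b c d : ℤ, a * d - b * c = 1 → P (a * x + b * y) (c * x + d * y)) :
    (∀ u v, P u v) ∨
      ∃ N : ℕ, 0 < N ∧ ∀ x y, P x y → ∃ a b : ℤ, x = a / N ∧ y = b / N := by
  by_cases hirr : ∃ x y, P x y ∧ (Irrational x ∨ Irrational y)
  · obtain ⟨x, y, h, hxy⟩ := hirr
    exact Or.inl (forall_of_irrational hP htr hSL hxy h)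
  by_cases hN : ∀ N : ℕ, ∃ q : ℕ, N < q ∧ ∀ j : ℤ, P (j / q) (1 / q)
  · exact Or.inl (forall_of_unbounded_denominators hP htr hSL hN)
  push Not at hirr hN
  obtain ⟨N, hN⟩ := hN
  refine Or.inr ⟨N.factorial, N.factorial_pos, fun x y h => ?_⟩
  obtain ⟨q, a, b, hq, ha, hb, hg⟩ := exists_common_denominator
    (hirr x y h).1 (hirr x y h).2
  have hqN : q ≤ N := by
    by_contra! hlt
    obtain ⟨j, hj⟩ := hN q hlt
    exact hj (int_div_one_div_of_rational htr hSL h hq ha hb hg j)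
  obtain ⟨k, hk⟩ := Nat.dvd_factorial hq hqN
  have hF : (N.factorial : ℝ) = q * k := by exact_mod_cast hk
  have hF0 : (N.factorial : ℝ) ≠ 0 := by exact_mod_cast N.factorial_ne_zero
  refine ⟨a * k, b * k, ?_, ?_⟩
  · rw [eq_div_iff hF0, hF]; push_cast; linear_combination (k : ℝ) * ha
  · rw [eq_div_iff hF0, hF]; push_cast; linear_combination (k : ℝ) * hb

theorem torus2_mk_add_int (x y : ℝ) (m n : ℤ) :
    (QuotientAddGroup.mk ![x + m, y + n] : Torus2) = QuotientAddGroup.mk ![x, y] := by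
  rw [eq_comm, QuotientAddGroup.eq]
  intro i
  fin_cases i
  · exact ⟨m, by simp⟩
  · exact ⟨n, by simp⟩

theorem torus2_finite_common_denominator {N : ℕ} (hN : 0 < N) :
    {p : Torus2 | ∃ a b : ℤ, p = QuotientAddGroup.mk ![(a / N : ℝ), b / N]}.Finite := by
  refine ((Set.finite_Ico (0 : ℤ) N).prod (Set.finite_Ico (0 : ℤ) N)).image
    (fun c => (QuotientAddGroup.mk ![(c.1 / N : ℝ), c.2 / N] : Torus2)) |>.subset ?_
  rintro _ ⟨a, b, rfl⟩
  have hN' : (0 : ℤ) < N := by exact_mod_cast hN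
  have key (a : ℤ) : (a / N : ℝ) = ((a % N : ℤ) : ℝ) / N + ((a / N : ℤ) : ℝ) := by
    have h : (a : ℝ) = ((a % N : ℤ) : ℝ) + N * ((a / N : ℤ) : ℝ) := by
      exact_mod_cast (Int.emod_add_mul_ediv a N).symm
    have h0 : (N : ℝ) ≠ 0 := by exact_mod_cast hN.ne'
    rw [div_add' _ _ _ h0, div_left_inj' h0]
    linear_combination h
  refine ⟨(a % N, b % N), ⟨⟨Int.emod_nonneg _ hN'.ne', Int.emod_lt_of_pos _ hN'⟩,
    ⟨Int.emod_nonneg _ hN'.ne', Int.emod_lt_of_pos _ hN'⟩⟩, ?_⟩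
  rw [key a, key b, torus2_mk_add_int]

/-- Benoist–Quint orbit-closure classification on the torus: every closed subset of
`𝕋² = ℝ²/ℤ²` invariant under the action of `SL(2,ℤ)` induced from the linear action on `ℝ²`
is either finite or all of `𝕋²`. -/
theorem SL2Z_invariant_closed_subset_of_torus_finite_or_univ
    (S : Set Torus2) (hS : IsClosed S)
    (hinv : ∀ A : Matrix.SpecialLinearGroup (Fin 2) ℤ, ∀ v : Fin 2 → ℝ,
      (QuotientAddGroup.mk v : Torus2) ∈ S →
      (QuotientAddGroup.mk
        (((A : Matrix (Fin 2) (Fin 2) ℤ).map (fun x => (x : ℝ))).mulVec v) : Torus2) ∈ S) :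
    S.Finite ∨ S = Set.univ := by
  have hmk : ∀ p : Torus2, ∃ x y : ℝ, p = QuotientAddGroup.mk ![x, y] := by
    intro p
    induction p using QuotientAddGroup.induction_on with
    | H v => exact ⟨v 0, v 1, congrArg _ (List.ofFn_inj.1 rfl)⟩
  have hcl : IsClosed {p : ℝ × ℝ | (QuotientAddGroup.mk ![p.1, p.2] : Torus2) ∈ S} := by
    refine hS.preimage (continuous_quotient_mk'.comp (?_ : Continuous fun p : ℝ × ℝ => ![p.1, p.2]))
    fun_prop
  rcases forall_or_exists_common_denominator
    (P := fun x y => (QuotientAddGroup.mk ![x, y] : Torus2) ∈ S) hcl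
    (fun x y h m n => by rwa [torus2_mk_add_int])
    (fun x y h a b c d hdet => by
      have := hinv ⟨!![a, b; c, d], by rw [Matrix.det_fin_two_of]; exact hdet⟩ ![x, y] h
      convert this using 2
      ext i
      fin_cases i <;> simp [Matrix.mulVec, dotProduct, Fin.sum_univ_two]) with hall | ⟨N, hN, hden⟩
  · right
    refine Set.eq_univ_of_forall fun p => ?_
    obtain ⟨x, y, rfl⟩ := hmk p
    exact hall x y
  · left
    refine (torus2_finite_common_denominator hN).subset fun p hp => ?_
    obtain ⟨x, y, rfl⟩ := hmk p
    obtain ⟨a, b, rfl, rfl⟩ := hden x y hp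
    exact ⟨a, b, rfl⟩
end

section
/- Let 𝕋² = ℝ²/ℤ² with the action of SL(2,ℤ) induced from the linear action on ℝ². Every non-atomic Borel probability measure ν on 𝕋² that is invariant under this action (the pushforward of ν by the map induced by each A ∈ SL(2,ℤ) equals ν) is equal to the Haar probability measure on 𝕋². -/
open MeasureTheory

/-- The Haar probability measure on `𝕋² = ℝ²/ℤ²`: the pushforward under the quotient map of
Lebesgue measure restricted to the fundamental domain `[0,1)²`. -/
noncomputable def haarTorus2 : Measure Torus2 :=
  Measure.map (QuotientAddGroup.mk : (Fin 2 → ℝ) → Torus2)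
    (volume.restrict (Set.univ.pi fun _ : Fin 2 => Set.Ico (0 : ℝ) 1))

/-- The integral of a nontrivial character of the circle vanishes. -/
lemma UnitAddCircle.integral_fourier_eq_zero {n : ℤ} (hn : n ≠ 0) :
    ∫ t : UnitAddCircle, fourier n t = 0 :=
  integral_eq_zero_of_add_right_eq_neg (fourier_add_half_inv_index hn one_pos)

namespace UnitAddTorus

/-- The integral of a nontrivial character of the torus vanishes. -/
lemma integral_mFourier_eq_zero {d : Type*} [Fintype d] {n : d → ℤ} (hn : n ≠ 0) :
    ∫ t, mFourier n t ∂(Measure.pi fun _ : d => (volume : Measure UnitAddCircle)) = 0 := by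
  obtain ⟨i, hi⟩ := Function.ne_iff.mp hn
  have h := integral_fintype_prod_eq_prod (μ := fun _ : d => (volume : Measure UnitAddCircle))
    (fun i => (fourier (n i) : UnitAddCircle → ℂ))
  refine h.trans (Finset.prod_eq_zero (Finset.mem_univ i) ?_)
  exact UnitAddCircle.integral_fourier_eq_zero hi

/-- A finite measure on the torus is determined by its Fourier coefficients. -/
lemma ext_of_integral_mFourier_eq {d : Type*} [Fintype d] {μ ν : Measure (UnitAddTorus d)}
    [IsFiniteMeasure μ] [IsFiniteMeasure ν]
    (h : ∀ n, ∫ t, mFourier n t ∂μ = ∫ t, mFourier n t ∂ν) : μ = ν := by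
  let A : StarSubalgebra ℂ (BoundedContinuousFunction (UnitAddTorus d) ℂ) :=
    (mFourierSubalgebra d).comap (BoundedContinuousFunction.toContinuousMapStarₐ ℂ)
  refine ext_of_forall_mem_subalgebra_integral_eq_of_polish (𝕜 := ℂ) (A := A) ?_ ?_
  · intro x y hxy
    obtain ⟨_, ⟨f, hf, rfl⟩, hne⟩ := mFourierSubalgebra_separatesPoints hxy
    exact ⟨f, ⟨f, ⟨BoundedContinuousFunction.mkOfCompact f, hf, rfl⟩, rfl⟩, hne⟩
  · intro g hg
    have hg' : (g : C(UnitAddTorus d, ℂ)) ∈ Submodule.span ℂ (Set.range (mFourier (d := d))) := by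
      rw [← mFourierSubalgebra_coe]
      exact hg
    have key : ∀ f ∈ Submodule.span ℂ (Set.range (mFourier (d := d))),
        ∫ t, f t ∂μ = ∫ t, f t ∂ν := by
      have hint : ∀ (ρ : Measure (UnitAddTorus d)) [IsFiniteMeasure ρ]
          (f : C(UnitAddTorus d, ℂ)), Integrable f ρ := fun ρ _ f =>
        (BoundedContinuousFunction.mkOfCompact f).integrable ρ
      intro f hf
      induction hf using Submodule.span_induction with
      | mem f hf =>
        obtain ⟨n, rfl⟩ := hf
        exact h n
      | zero => simp
      | add f g _ _ hf hg =>
        simp only [ContinuousMap.add_apply]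
        rw [integral_add (hint μ f) (hint μ g), integral_add (hint ν f) (hint ν g), hf, hg]
      | smul c f _ hf =>
        simp only [ContinuousMap.smul_apply]
        rw [integral_smul, integral_smul, hf]
    exact key _ hg'

/-- The endomorphism of the torus induced by an integer matrix. -/
def matrixMap {d : Type*} [Fintype d] (A : Matrix d d ℤ) (t : UnitAddTorus d) : UnitAddTorus d :=
  fun i => ∑ j, A i j • t j

lemma continuous_matrixMap {d : Type*} [Fintype d] (A : Matrix d d ℤ) :
    Continuous (matrixMap A) := by
  unfold matrixMap
  fun_prop

lemma measurable_matrixMap {d : Type*} [Fintype d] (A : Matrix d d ℤ) :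
    Measurable (matrixMap A) :=
  (continuous_matrixMap A).measurable

section Invariant

variable {μ : Measure (UnitAddTorus (Fin 2))} [IsProbabilityMeasure μ]

/-- The set of points killed by a nonzero integer is finite. -/
lemma finite_setOf_zsmul_eq_zero {d : Type*} [Finite d] {m : ℤ} (hm : m ≠ 0) :
    {t : UnitAddTorus d | m • t = 0}.Finite := by
  have h := AddCircle.finite_torsion (1 : ℝ) (Int.natAbs_pos.mpr hm)
  refine (Set.Finite.pi' fun _ : d => h).subset fun t ht i => ?_
  have : m • t i = 0 := congrFun ht i
  rcases Int.natAbs_eq m with h' | h' <;> rw [h'] at this <;> simpa using this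

/-- An invariant non-atomic probability measure gives zero mass to rational circles. -/
lemma measure_zsmul_eq_zero (hna : ∀ t, μ {t} = 0)
    (hinv : ∀ A : Matrix.SpecialLinearGroup (Fin 2) ℤ, μ.map (matrixMap A.1) = μ)
    {n : ℤ} (hn : n ≠ 0) : μ {t | n • t 1 = 0} = 0 := by
  have : NullSingletonClass μ := ⟨hna⟩
  let E : ℤ → Set (UnitAddTorus (Fin 2)) := fun k => {t | n • (k • t 0 + t 1) = 0}
  have hEm : ∀ k, MeasurableSet (E k) := fun k =>
    (isClosed_eq (by fun_prop) continuous_const).measurableSet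
  have hE : ∀ k, μ (E k) = μ {t | n • t 1 = 0} := by
    intro k
    have hm : MeasurableSet {t : UnitAddTorus (Fin 2) | n • t 1 = 0} :=
      (isClosed_eq (by fun_prop) continuous_const).measurableSet
    conv_rhs => rw [← hinv ⟨!![1, 0; k, 1], by simp [Matrix.det_fin_two]⟩,
      Measure.map_apply (measurable_matrixMap _) hm]
    congr 1
    ext t
    simp [E, matrixMap, Fin.sum_univ_two]
  have hd : Pairwise (Function.onFun (AEDisjoint μ) E) := by
    intro k l hkl
    have hm : n * (k - l) ≠ 0 := mul_ne_zero hn (sub_ne_zero.mpr hkl)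
    refine ((finite_setOf_zsmul_eq_zero (d := Fin 2) (mul_ne_zero hn hm)).subset
      fun t ht => ?_).measure_zero μ
    obtain ⟨h1 : n • (k • t 0 + t 1) = 0, h2 : n • (l • t 0 + t 1) = 0⟩ := ht
    have h0 : (n * (k - l)) • t 0 = 0 := by
      have : (n * (k - l)) • t 0 = n • (k • t 0 + t 1) - n • (l • t 0 + t 1) := by module
      rw [this, h1, h2, sub_zero]
    funext i
    fin_cases i
    · have : (n * (n * (k - l))) • t 0 = n • ((n * (k - l)) • t 0) := by module
      simpa [h0] using this
    · have : (n * (n * (k - l))) • t 1 =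
          (n * (k - l)) • (n • (k • t 0 + t 1)) - (n * k) • ((n * (k - l)) • t 0) := by module
      simpa [h0, h1] using this
  by_contra hpos
  have hfin := Measure.finite_const_le_meas_of_disjoint_iUnion₀ μ (pos_iff_ne_zero.mpr hpos)
    (fun k => (hEm k).nullMeasurableSet) hd (measure_ne_top _ _)
  refine Set.infinite_univ (α := ℤ) (hfin.subset fun k _ => (hE k).ge)

/-- Cesàro means of the powers of a nontrivial unit complex number tend to zero. -/
lemma tendsto_cesaro_pow_zero {z : ℂ} (hz : ‖z‖ ≤ 1) (hz1 : z ≠ 1) :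
    Filter.Tendsto (fun N : ℕ => (N : ℂ)⁻¹ * ∑ k ∈ Finset.range N, z ^ k) Filter.atTop
      (nhds 0) := by
  refine squeeze_zero_norm (a := fun N : ℕ => (N : ℝ)⁻¹ * (2 / ‖z - 1‖)) (fun N => ?_) ?_
  · rw [norm_mul, norm_inv, Complex.norm_natCast, geom_sum_eq hz1, norm_div]
    gcongr
    calc ‖z ^ N - 1‖ ≤ ‖z ^ N‖ + ‖(1 : ℂ)‖ := norm_sub_le _ _
      _ ≤ 1 + 1 := by
        rw [norm_pow, norm_one]
        gcongr
        exact pow_le_one₀ (norm_nonneg _) hz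
      _ = 2 := by norm_num
  · simpa using (tendsto_inv_atTop_nhds_zero_nat (𝕜 := ℝ)).mul_const (2 / ‖z - 1‖)

/-- The Fourier coefficients of an invariant non-atomic probability measure vanish at
frequencies with nonzero first entry. -/
lemma integral_mFourier_eq_zero_of_apply_zero_ne (hna : ∀ t, μ {t} = 0)
    (hinv : ∀ A : Matrix.SpecialLinearGroup (Fin 2) ℤ, μ.map (matrixMap A.1) = μ)
    {n : Fin 2 → ℤ} (hn : n 0 ≠ 0) : ∫ t, mFourier n t ∂μ = 0 := by
  have hshift : ∀ k : ℕ, ∫ t, mFourier n t ∂μ =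
      ∫ t, fourier (n 0) (t 1) ^ k * mFourier n t ∂μ := by
    intro k
    conv_lhs => rw [← hinv ⟨!![1, (k : ℤ); 0, 1], by simp [Matrix.det_fin_two]⟩,
      integral_map (measurable_matrixMap _).aemeasurable
        (mFourier n).continuous.aestronglyMeasurable]
    refine integral_congr_ae (.of_forall fun t => ?_)
    simp [mFourier, matrixMap, Fin.sum_univ_two, fourier_apply, smul_add, smul_comm (n 0),
      AddCircle.toCircle_add, AddCircle.toCircle_nsmul]
    ring
  have hcont : ∀ N : ℕ, Continuous fun t : UnitAddTorus (Fin 2) =>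
      ((N : ℂ)⁻¹ * ∑ k ∈ Finset.range N, fourier (n 0) (t 1) ^ k) * mFourier n t := by
    intro N
    fun_prop
  have hnorm : ∀ t : UnitAddTorus (Fin 2), ‖mFourier n t‖ ≤ 1 := fun t =>
    ((mFourier n).norm_coe_le_norm t).trans mFourier_norm.le
  have hz : ∀ x : UnitAddCircle, ‖fourier (n 0) x‖ = 1 := fun x => Circle.norm_coe _
  have hmean : ∀ N : ℕ, N ≠ 0 → ∫ t, ((N : ℂ)⁻¹ * ∑ k ∈ Finset.range N,
      fourier (n 0) (t 1) ^ k) * mFourier n t ∂μ = ∫ t, mFourier n t ∂μ := by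
    intro N hN
    simp_rw [mul_assoc, Finset.sum_mul]
    rw [integral_const_mul, integral_finsetSum]
    · simp_rw [← hshift]
      simp [hN]
    · intro k _
      refine Integrable.of_bound (C := 1) ?_ (.of_forall fun t => ?_)
      · exact Continuous.aestronglyMeasurable (by fun_prop)
      · rw [norm_mul, norm_pow, hz, one_pow, one_mul]
        exact hnorm t
  have hlim : Filter.Tendsto (fun N : ℕ => ∫ t, ((N : ℂ)⁻¹ * ∑ k ∈ Finset.range N,
      fourier (n 0) (t 1) ^ k) * mFourier n t ∂μ) Filter.atTop (nhds (∫ _, (0 : ℂ) ∂μ)) := by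
    refine tendsto_integral_of_dominated_convergence (fun _ => 1)
      (fun N => (hcont N).aestronglyMeasurable) (integrable_const _)
      (fun N => .of_forall fun t => ?_) ?_
    · rw [norm_mul]
      refine mul_le_one₀ ?_ (norm_nonneg _) (hnorm t)
      rw [norm_mul, norm_inv, Complex.norm_natCast]
      refine inv_mul_le_one_of_le₀ ?_ (Nat.cast_nonneg N)
      refine (norm_sum_le _ _).trans ?_
      simp_rw [norm_pow, hz]
      simp
    · have hae : ∀ᵐ t ∂μ, n 0 • t 1 ≠ 0 := by
        simpa [ae_iff] using measure_zsmul_eq_zero hna hinv hn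
      filter_upwards [hae] with t ht
      have h1 : fourier (n 0) (t 1) ≠ 1 := by
        rw [fourier_apply]
        intro h
        refine ht (AddCircle.injective_toCircle one_ne_zero ?_)
        rw [AddCircle.toCircle_zero]
        exact Circle.ext h
      simpa using (tendsto_cesaro_pow_zero (hz (t 1)).le h1).mul_const (mFourier n t)
  rw [integral_zero] at hlim
  refine tendsto_nhds_unique (tendsto_const_nhds.congr' ?_) hlim
  filter_upwards [Filter.eventually_ne_atTop 0] with N hN
  exact (hmean N hN).symm

/-- A non-atomic probability measure on the two-dimensional torus which is invariant under
`SL(2, ℤ)` is the Haar measure. -/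
theorem eq_pi_volume_of_invariant (hna : ∀ t, μ {t} = 0)
    (hinv : ∀ A : Matrix.SpecialLinearGroup (Fin 2) ℤ, μ.map (matrixMap A.1) = μ) :
    μ = Measure.pi fun _ : Fin 2 => (volume : Measure UnitAddCircle) := by
  refine ext_of_integral_mFourier_eq fun n => ?_
  by_cases hn : n = 0
  · have : IsProbabilityMeasure (volume : Measure UnitAddCircle) := ⟨UnitAddCircle.measure_univ⟩
    simp [hn, mFourier_zero]
  rw [integral_mFourier_eq_zero hn]
  by_cases h0 : n 0 = 0
  · have h1 : n 1 ≠ 0 := fun h1 => hn (by ext i; fin_cases i <;> simpa)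
    rw [← hinv ⟨!![0, -1; 1, 0], by simp [Matrix.det_fin_two]⟩,
      integral_map (measurable_matrixMap _).aemeasurable
        (mFourier n).continuous.aestronglyMeasurable]
    refine Eq.trans (integral_congr_ae (.of_forall fun t => ?_))
      (integral_mFourier_eq_zero_of_apply_zero_ne hna hinv (n := ![n 1, -n 0]) (by simpa))
    simp [mFourier, matrixMap, Fin.sum_univ_two, fourier_apply, h0]
  · exact integral_mFourier_eq_zero_of_apply_zero_ne hna hinv h0

end Invariant

end UnitAddTorus

namespace Torus2

lemma mk_eq_mk_iff (v w : Fin 2 → ℝ) :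
    (QuotientAddGroup.mk v : Torus2) = QuotientAddGroup.mk w ↔
      ∀ i, (v i : UnitAddCircle) = (w i : UnitAddCircle) := by
  rw [QuotientAddGroup.eq]
  refine forall_congr' fun i => ?_
  rw [QuotientAddGroup.eq, AddSubgroup.mem_zmultiples_iff]
  simp [eq_comm]

/-- The comparison map from `ℝ²/ℤ²` to `(ℝ/ℤ)²`. -/
def toUnitAddTorus (x : Torus2) : UnitAddTorus (Fin 2) :=
  Quotient.lift (fun (v : Fin 2 → ℝ) i => (v i : UnitAddCircle))
    (fun v w h => funext ((mk_eq_mk_iff v w).mp (Quotient.sound h))) x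

lemma toUnitAddTorus_mk (v : Fin 2 → ℝ) :
    toUnitAddTorus (QuotientAddGroup.mk v) = fun i => (v i : UnitAddCircle) := rfl

lemma measurable_coe : Measurable fun (v : Fin 2 → ℝ) i => (v i : UnitAddCircle) :=
  measurable_pi_lambda _ fun i => AddCircle.measurable_mk'.comp (measurable_pi_apply i)

lemma measurable_toUnitAddTorus : Measurable toUnitAddTorus :=
  QuotientAddGroup.measurable_from_quotient.mpr measurable_coe

/-- The inverse of the comparison map, through the fundamental domain `[0,1)²`. -/
noncomputable def ofUnitAddTorus (t : UnitAddTorus (Fin 2)) : Torus2 :=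
  QuotientAddGroup.mk fun i => (AddCircle.measurableEquivIco 1 0 (t i) : ℝ)

lemma measurable_ofUnitAddTorus : Measurable ofUnitAddTorus :=
  QuotientAddGroup.measurable_coe.comp (measurable_pi_lambda _ fun i =>
    measurable_subtype_coe.comp
      ((AddCircle.measurableEquivIco 1 0).measurable.comp (measurable_pi_apply i)))

lemma ofUnitAddTorus_toUnitAddTorus (x : Torus2) : ofUnitAddTorus (toUnitAddTorus x) = x := by
  induction x using QuotientAddGroup.induction_on with
  | H v => exact (mk_eq_mk_iff _ _).mpr fun i => AddCircle.coe_equivIco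

lemma map_haarTorus2_toUnitAddTorus :
    haarTorus2.map toUnitAddTorus =
      Measure.pi fun _ : Fin 2 => (volume : Measure UnitAddCircle) := by
  rw [haarTorus2, Measure.map_map measurable_toUnitAddTorus QuotientAddGroup.measurable_coe,
    volume_pi, Measure.restrict_pi_pi]
  have h : MeasurePreserving (fun x : ℝ => (x : UnitAddCircle))
      (volume.restrict (Set.Ico (0 : ℝ) 1)) volume := by
    have := UnitAddCircle.measurePreserving_mk 0
    rwa [zero_add, ← restrict_Ico_eq_restrict_Ioc] at this
  exact (measurePreserving_pi _ _ fun _ : Fin 2 => h).map_eq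

lemma toUnitAddTorus_mulVec (A : Matrix (Fin 2) (Fin 2) ℤ) (v : Fin 2 → ℝ) :
    toUnitAddTorus (QuotientAddGroup.mk ((A.map fun x => (x : ℝ)).mulVec v)) =
      UnitAddTorus.matrixMap A (toUnitAddTorus (QuotientAddGroup.mk v)) := by
  funext i
  simp only [toUnitAddTorus_mk, UnitAddTorus.matrixMap, Matrix.mulVec, dotProduct, Matrix.map_apply,
    Fin.sum_univ_two, AddCircle.coe_add, ← zsmul_eq_mul, AddCircle.coe_zsmul]

lemma toUnitAddTorus_ofUnitAddTorus (t : UnitAddTorus (Fin 2)) :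
    toUnitAddTorus (ofUnitAddTorus t) = t :=
  funext fun _ => AddCircle.coe_equivIco

end Torus2

/-- Benoist–Quint (invariant-measure case): every non-atomic Borel probability measure on
`𝕋² = ℝ²/ℤ²` invariant under the `SL(2,ℤ)`-action induced from the linear action on `ℝ²`
is the Haar probability measure. -/
theorem SL2Z_invariant_nonatomic_measure_is_haar
    (ν : Measure Torus2) [IsProbabilityMeasure ν]
    (hna : ∀ x : Torus2, ν {x} = 0)
    (hinv : ∀ A : Matrix.SpecialLinearGroup (Fin 2) ℤ, ∀ φ : Torus2 → Torus2,
      (∀ v : Fin 2 → ℝ,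
        φ (QuotientAddGroup.mk v) =
          (QuotientAddGroup.mk
            (((A : Matrix (Fin 2) (Fin 2) ℤ).map (fun x => (x : ℝ))).mulVec v) : Torus2)) →
      Measure.map φ ν = ν) :
    ν = haarTorus2 := by
  have hφ : ∀ A : Matrix.SpecialLinearGroup (Fin 2) ℤ,
      (ν.map Torus2.toUnitAddTorus).map (UnitAddTorus.matrixMap A.1) =
        ν.map Torus2.toUnitAddTorus := by
    intro A
    let φ : Torus2 → Torus2 := fun x =>
      Torus2.ofUnitAddTorus (UnitAddTorus.matrixMap A.1 (Torus2.toUnitAddTorus x))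
    have hφm : Measurable φ := Torus2.measurable_ofUnitAddTorus.comp
      ((UnitAddTorus.measurable_matrixMap A.1).comp Torus2.measurable_toUnitAddTorus)
    have hν : ν.map φ = ν := hinv A φ fun v => by
      simp only [φ]
      rw [← Torus2.toUnitAddTorus_mulVec, Torus2.ofUnitAddTorus_toUnitAddTorus]
    conv_rhs => rw [← hν]
    rw [Measure.map_map (UnitAddTorus.measurable_matrixMap A.1) Torus2.measurable_toUnitAddTorus,
      Measure.map_map Torus2.measurable_toUnitAddTorus hφm]
    congr 1
    funext x
    exact (Torus2.toUnitAddTorus_ofUnitAddTorus _).symm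
  have : IsProbabilityMeasure (ν.map Torus2.toUnitAddTorus) :=
    Measure.isProbabilityMeasure_map Torus2.measurable_toUnitAddTorus.aemeasurable
  have hatom : ∀ t, ν.map Torus2.toUnitAddTorus {t} = 0 := by
    intro t
    rw [Measure.map_apply Torus2.measurable_toUnitAddTorus (measurableSet_singleton t)]
    refine measure_mono_null (fun x hx => ?_) (hna (Torus2.ofUnitAddTorus t))
    rw [Set.mem_singleton_iff, ← Set.mem_singleton_iff.mp hx,
      Torus2.ofUnitAddTorus_toUnitAddTorus]
  have hmap : ν.map Torus2.toUnitAddTorus = haarTorus2.map Torus2.toUnitAddTorus := by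
    rw [Torus2.map_haarTorus2_toUnitAddTorus]
    exact UnitAddTorus.eq_pi_volume_of_invariant hatom hφ
  have hid : ∀ ρ : Measure Torus2,
      (ρ.map Torus2.toUnitAddTorus).map Torus2.ofUnitAddTorus = ρ := by
    intro ρ
    rw [Measure.map_map Torus2.measurable_ofUnitAddTorus Torus2.measurable_toUnitAddTorus,
      show Torus2.ofUnitAddTorus ∘ Torus2.toUnitAddTorus = id from
        funext Torus2.ofUnitAddTorus_toUnitAddTorus, Measure.map_id]
  rw [← hid ν, hmap, hid]
end
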